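/- Let d : ℕ → ℝ be a binary digit sequence (d i ∈ {0,1} for all i), with complement sequence dᶜ i = 1 − d i. For each n ≥ 1 let w n and wᶜ n be the non-standard vector representations (in EuclideanSpace ℝ (Fin (2^n − 1))) of the first n digits of d and of dᶜ respectively. Then for every n ≥ 1: √(‖w n‖² + ‖wᶜ n‖²) = √(2^n − 1). -/

import Mathlib

open Real Filter

theorem sum_Icc_two_pow_sub_add {n k : ℕ} (hk : k ≤ n) :
    (∑ m ∈ Finset.Icc 1 k, 2 ^ (n - m)) + 2 ^ (n - k) = 2 ^ n := by
  induction k with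
  | zero => simp
  | succ k ih =>
    rw [Finset.sum_Icc_succ_top (by omega), add_assoc, ← two_mul, ← pow_succ',
      show n - (k + 1) + 1 = n - k by omega]
    exact ih (by omega)

/-- Every position below `2 ^ n - 1` lies in one of the `n` consecutive blocks. -/
theorem exists_block_of_lt {n j : ℕ} (hj : j < 2 ^ n - 1) :
    ∃ k, 1 ≤ k ∧ k ≤ n ∧ (∑ m ∈ Finset.Icc 1 (k - 1), 2 ^ (n - m)) ≤ j ∧
      j < ∑ m ∈ Finset.Icc 1 k, 2 ^ (n - m) := by
  have hlast : j < ∑ m ∈ Finset.Icc 1 n, 2 ^ (n - m) := by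
    have h := sum_Icc_two_pow_sub_add (le_refl n)
    simp only [Nat.sub_self, pow_zero] at h
    omega
  have hex : ∃ k, j < ∑ m ∈ Finset.Icc 1 k, 2 ^ (n - m) := ⟨n, hlast⟩
  have hpos : 1 ≤ Nat.find hex := by
    rw [Nat.one_le_iff_ne_zero]
    intro h0
    have h := Nat.find_spec hex
    rw [h0] at h
    simp at h
  exact ⟨Nat.find hex, hpos, Nat.find_min' hex hlast,
    not_lt.mp (Nat.find_min hex (by omega)), Nat.find_spec hex⟩

/-- For a binary digit sequence `d` with complement `dᶜ i = 1 - d i` and `n ≥ 1`, let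
`w` and `wᶜ` be the non-standard vector representations in `ℝ^(2^n - 1)` of the first
`n` digits of `d` and of `dᶜ` respectively (for `k = 1, …, n`, block `k` consists of the
`2^(n-k)` coordinates at positions `∑_{m=1}^{k-1} 2^(n-m) ≤ j < ∑_{m=1}^{k} 2^(n-m)`,
all equal to the `k`-th digit).  Then `√(‖w‖² + ‖wᶜ‖²) = √(2^n - 1)`. -/
theorem stmt_6 (d : ℕ → ℝ) (hd : ∀ i, d i = 0 ∨ d i = 1) (n : ℕ) (hn : 1 ≤ n)
    (w wc : EuclideanSpace ℝ (Fin (2 ^ n - 1)))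
    (hw : ∀ k, 1 ≤ k → k ≤ n → ∀ j : Fin (2 ^ n - 1),
      (∑ m ∈ Finset.Icc 1 (k - 1), 2 ^ (n - m)) ≤ (j : ℕ) →
      (j : ℕ) < ∑ m ∈ Finset.Icc 1 k, 2 ^ (n - m) →
      w j = d (k - 1))
    (hwc : ∀ k, 1 ≤ k → k ≤ n → ∀ j : Fin (2 ^ n - 1),
      (∑ m ∈ Finset.Icc 1 (k - 1), 2 ^ (n - m)) ≤ (j : ℕ) →
      (j : ℕ) < ∑ m ∈ Finset.Icc 1 k, 2 ^ (n - m) →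
      wc j = 1 - d (k - 1)) :
    Real.sqrt (‖w‖ ^ 2 + ‖wc‖ ^ 2) = Real.sqrt (2 ^ n - 1) := by
  congr 1
  have hsum : ∀ j, w j ^ 2 + wc j ^ 2 = 1 := by
    intro j
    obtain ⟨k, hk, hkn, hlo, hhi⟩ := exists_block_of_lt j.isLt
    rw [hw k hk hkn j hlo hhi, hwc k hk hkn j hlo hhi]
    rcases hd (k - 1) with h | h <;> rw [h] <;> norm_num
  rw [EuclideanSpace.real_norm_sq_eq, EuclideanSpace.real_norm_sq_eq,
    ← Finset.sum_add_distrib, Finset.sum_congr rfl fun j _ => hsum j]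
  simp [Nat.cast_sub Nat.one_le_two_pow]
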